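/- If v and w are two operation sequences that produce the same permutation and both output eagerly, then v and w have the same type: for every position j, the j-th letter of v is an input letter (I1 or I2) if and only if the j-th letter of w is an input letter. -/

import Mathlib

/-!
Two stacks in parallel: operation sequences over the alphabet {I1, I2, O1, O2}.
-/

inductive Op : Type
  | I1 | I2 | O1 | O2
  deriving DecidableEq

/-- Machine state: (next unread input item, stack 1, stack 2, output so far). -/
abbrev MState := ℕ × List ℕ × List ℕ × List ℕ

/-- One step of the two-stack machine. -/
def mstep : MState → Op → MState
  | (k, s1, s2, out), Op.I1 => (k + 1, k :: s1, s2, out)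
  | (k, s1, s2, out), Op.I2 => (k + 1, s1, k :: s2, out)
  | (k, s1, s2, out), Op.O1 => (k, s1.tail, s2, out ++ [s1.headI])
  | (k, s1, s2, out), Op.O2 => (k, s1, s2.tail, out ++ [s2.headI])

/-- Run a word on the two-stack machine, starting with input item 1. -/
def mrun (w : List Op) : MState := w.foldl mstep (1, [], [], [])

/-- The output word (the permutation produced, as a list). -/
def output (w : List Op) : List ℕ := (mrun w).2.2.2

def h1 : Op → ℤ
  | Op.I1 => 1
  | Op.O1 => -1
  | _ => 0

def h2 : Op → ℤ
  | Op.I2 => 1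
  | Op.O2 => -1
  | _ => 0

/-- `w` is an operation sequence: each projection on `{Ii, Oi}` is a Dyck word. -/
def IsOpSeq (w : List Op) : Prop :=
  (w.map h1).sum = 0 ∧ (w.map h2).sum = 0 ∧
    ∀ p ∈ w.inits, 0 ≤ (p.map h1).sum ∧ 0 ≤ (p.map h2).sum

/-- `w` outputs eagerly: it contains neither `I1 O2` nor `I2 O1` as a factor. -/
def Eager (w : List Op) : Prop :=
  ¬ [Op.I1, Op.O2] <:+: w ∧ ¬ [Op.I2, Op.O1] <:+: w

/-- `true` for input letters `I1`, `I2`; `false` for output letters. -/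
def isInput : Op → Bool
  | Op.I1 => true
  | Op.I2 => true
  | _ => false

/-- The input counter is positive and exceeds every item held in the stacks. -/
def MState.Bounded (s : MState) : Prop :=
  0 < s.1 ∧ (∀ x ∈ s.2.1, x < s.1) ∧ ∀ x ∈ s.2.2.1, x < s.1

theorem Eager.of_cons {c : Op} {w : List Op} (h : Eager (c :: w)) : Eager w :=
  ⟨fun h' => h.1 (List.infix_cons h'), fun h' => h.2 (List.infix_cons h')⟩

theorem headI_lt_of_forall_lt {l : List ℕ} {k : ℕ} (hk : 0 < k) (h : ∀ x ∈ l, x < k) :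
    l.headI < k := by
  cases l with
  | nil => exact hk
  | cons a l => exact h a (by simp)

theorem MState.Bounded.mstep {s : MState} (hs : s.Bounded) (c : Op) :
    MState.Bounded (mstep s c) := by
  obtain ⟨k, s1, s2, out⟩ := s
  obtain ⟨hk, h1, h2⟩ := hs
  simp only at hk h1 h2
  cases c
  · refine ⟨Nat.succ_pos _, fun x hx => ?_, fun x hx => Nat.lt_succ_of_lt (h2 x hx)⟩
    rcases List.mem_cons.1 hx with rfl | hx
    · exact Nat.lt_succ_self _
    · exact Nat.lt_succ_of_lt (h1 x hx)
  · refine ⟨Nat.succ_pos _, fun x hx => Nat.lt_succ_of_lt (h1 x hx), fun x hx => ?_⟩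
    rcases List.mem_cons.1 hx with rfl | hx
    · exact Nat.lt_succ_self _
    · exact Nat.lt_succ_of_lt (h2 x hx)
  · exact ⟨hk, fun x hx => h1 x (List.mem_of_mem_tail hx), h2⟩
  · exact ⟨hk, h1, fun x hx => h2 x (List.mem_of_mem_tail hx)⟩

theorem exists_foldl_mstep_output_eq_append (w : List Op) (s : MState) :
    ∃ l, (w.foldl mstep s).2.2.2 = s.2.2.2 ++ l := by
  induction w generalizing s with
  | nil => exact ⟨[], by simp⟩
  | cons c w ih =>
    obtain ⟨l, hl⟩ := ih (mstep s c)
    rw [List.foldl_cons, hl]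
    obtain ⟨k, s1, s2, out⟩ := s
    cases c <;> simp [mstep]

theorem foldl_mstep_counter_eq (w : List Op) (s : MState) :
    ((w.foldl mstep s).1 : ℤ) - (w.foldl mstep s).2.2.2.length =
      s.1 - s.2.2.2.length + (w.map h1).sum + (w.map h2).sum := by
  induction w generalizing s with
  | nil => simp
  | cons c w ih =>
    rw [List.foldl_cons, ih]
    obtain ⟨k, s1, s2, out⟩ := s
    cases c <;> simp [mstep, h1, h2] <;> ring

theorem foldl_mstep_counter_add_length (w : List Op) (s : MState) :
    (w.foldl mstep s).1 + (w.foldl mstep s).2.2.2.length = s.1 + s.2.2.2.length + w.length := by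
  induction w generalizing s with
  | nil => simp
  | cons c w ih =>
    rw [List.foldl_cons, ih]
    obtain ⟨k, s1, s2, out⟩ := s
    cases c <;> simp [mstep] <;> ring

theorem mstep_of_isInput {c : Op} (hc : isInput c = true) (s : MState) :
    (mstep s c).1 = s.1 + 1 ∧ (mstep s c).2.2.2 = s.2.2.2 := by
  cases c <;> simp_all [mstep, isInput]

theorem exists_mstep_of_not_isInput {c : Op} (hc : isInput c = false) (s : MState) :
    (mstep s c).1 = s.1 ∧ ∃ x, (mstep s c).2.2.2 = s.2.2.2 ++ [x] := by
  cases c <;> simp_all [mstep, isInput]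

/-- After an input step, an eager word next outputs an item that had not been read before. -/
theorem Eager.counter_le_of_input {c : Op} {w : List Op} (h : Eager (c :: w))
    (hc : isInput c = true) (s : MState) :
    ∃ l, ((c :: w).foldl mstep s).2.2.2 = s.2.2.2 ++ l ∧ ∀ x ∈ l.head?, s.1 ≤ x := by
  induction w generalizing c s with
  | nil =>
    obtain ⟨k, s1, s2, out⟩ := s
    refine ⟨[], ?_, by simp⟩
    cases c <;> simp_all [mstep, isInput]
  | cons d w ih =>
    by_cases hd : isInput d = true
    · obtain ⟨l, hl, hlx⟩ := ih h.of_cons hd (mstep s c)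
      refine ⟨l, ?_, fun x hx => ?_⟩
      · rw [List.foldl_cons, hl]
        obtain ⟨k, s1, s2, out⟩ := s
        cases c <;> simp_all [mstep, isInput]
      · have := hlx x hx
        obtain ⟨k, s1, s2, out⟩ := s
        cases c <;> simp_all [mstep, isInput] <;> omega
    · obtain ⟨l, hl⟩ := exists_foldl_mstep_output_eq_append w (mstep (mstep s c) d)
      obtain ⟨k, s1, s2, out⟩ := s
      refine ⟨k :: l, ?_, by simp⟩
      rw [List.foldl_cons, List.foldl_cons, hl]
      have h12 : ¬ (c = Op.I1 ∧ d = Op.O2) := by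
        rintro ⟨rfl, rfl⟩
        exact h.1 ⟨[], w, rfl⟩
      have h21 : ¬ (c = Op.I2 ∧ d = Op.O1) := by
        rintro ⟨rfl, rfl⟩
        exact h.2 ⟨[], w, rfl⟩
      cases c <;> cases d <;> simp_all [mstep, isInput]

/-- From states with equal counter and output, an output step and an eager input step lead to
different outputs. -/
theorem Eager.output_ne_of_input_of_output {c d : Op} {v w : List Op} (h : Eager (c :: v))
    (hc : isInput c = true) (hd : isInput d = false) {s t : MState} (ht : t.Bounded)
    (hk : s.1 = t.1) (ho : s.2.2.2 = t.2.2.2) :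
    ((c :: v).foldl mstep s).2.2.2 ≠ ((d :: w).foldl mstep t).2.2.2 := by
  obtain ⟨l, hl, hlx⟩ := h.counter_le_of_input hc s
  obtain ⟨m, hm⟩ := exists_foldl_mstep_output_eq_append w (mstep t d)
  rw [hl, List.foldl_cons, hm, ho]
  rw [hk] at hlx
  obtain ⟨k, t1, t2, out⟩ := t
  obtain ⟨hpos, ht1, ht2⟩ := ht
  have lt1 := headI_lt_of_forall_lt hpos ht1
  have lt2 := headI_lt_of_forall_lt hpos ht2
  intro heq
  cases d <;> simp [isInput, mstep] at hd heq lt1 lt2 hlx hk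
  all_goals
    subst heq
    simp at hlx
    omega

theorem map_isInput_eq_of_eager {v w : List Op} (hv : Eager v) (hw : Eager w)
    (hlen : v.length = w.length) {s t : MState} (hs : s.Bounded) (ht : t.Bounded)
    (hk : s.1 = t.1) (ho : s.2.2.2 = t.2.2.2)
    (hout : (v.foldl mstep s).2.2.2 = (w.foldl mstep t).2.2.2) :
    v.map isInput = w.map isInput := by
  induction v generalizing w s t with
  | nil => rw [List.length_eq_zero_iff.1 hlen.symm]
  | cons c v ih =>
    cases w with
    | nil => simp at hlen
    | cons d w =>
      have step : (mstep s c).1 = (mstep t d).1 → (mstep s c).2.2.2 = (mstep t d).2.2.2 →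
          v.map isInput = w.map isInput := fun hk' ho' =>
        ih hv.of_cons hw.of_cons (by simpa using hlen) (hs.mstep c) (ht.mstep d) hk' ho' hout
      rw [List.map_cons, List.map_cons]
      cases hc : isInput c <;> cases hd : isInput d
      · obtain ⟨hsk, x, hx⟩ := exists_mstep_of_not_isInput hc s
        obtain ⟨htk, y, hy⟩ := exists_mstep_of_not_isInput hd t
        obtain ⟨l, hl⟩ := exists_foldl_mstep_output_eq_append v (mstep s c)
        obtain ⟨m, hm⟩ := exists_foldl_mstep_output_eq_append w (mstep t d)
        have hxy : x = y := by
          rw [List.foldl_cons, List.foldl_cons, hl, hm, hx, hy, ho] at hout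
          simp at hout
          exact hout.1
        rw [step (by rw [hsk, htk, hk]) (by rw [hx, hy, ho, hxy])]
      · exact absurd hout.symm (hw.output_ne_of_input_of_output hd hc hs hk.symm ho.symm)
      · exact absurd hout (hv.output_ne_of_input_of_output hc hd ht hk ho)
      · obtain ⟨hsk, hx⟩ := mstep_of_isInput hc s
        obtain ⟨htk, hy⟩ := mstep_of_isInput hd t
        rw [step (by rw [hsk, htk, hk]) (by rw [hx, hy, ho])]

/-- If `v` and `w` are two operation sequences that produce the same permutation
and both output eagerly, then they have the same type: at every position, the
letter of `v` is an input letter if and only if the letter of `w` is. -/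
theorem eager_same_type (v w : List Op) (hv : IsOpSeq v) (hw : IsOpSeq w)
    (hev : Eager v) (hew : Eager w) (hout : output v = output w) :
    v.map isInput = w.map isInput := by
  have hb : MState.Bounded (1, [], [], []) := by simp [MState.Bounded]
  refine map_isInput_eq_of_eager hev hew ?_ hb hb rfl rfl hout
  have hcv := foldl_mstep_counter_eq v (1, [], [], [])
  have hcw := foldl_mstep_counter_eq w (1, [], [], [])
  have hlv := foldl_mstep_counter_add_length v (1, [], [], [])
  have hlw := foldl_mstep_counter_add_length w (1, [], [], [])
  have hlen : (v.foldl mstep (1, [], [], [])).2.2.2.length =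
      (w.foldl mstep (1, [], [], [])).2.2.2.length := congrArg List.length hout
  rw [hv.1, hv.2.1] at hcv
  rw [hw.1, hw.2.1] at hcw
  omega
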